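/- For a sign sequence r ∈ {−1, 1}^ℕ, height(f_r) = 2/3 if and only if either r_n = 1 for all n ≥ 1 or r_n = −1 for all n ≥ 1. Consequently there are exactly four functions in the class of signed Takagi functions with height 2/3: the Takagi function T (r_n = 1 for all n), its negative −T, and the functions ±T̃ where T̃(x) = T(x) − 2φ(x). -/

import Mathlib

/-- `phi x` is the distance from `x` to the nearest integer. -/
noncomputable def phi (x : ℝ) : ℝ := |x - round x|

/-- The signed Takagi function associated to the sign sequence `r`. -/
noncomputable def takagi (r : ℕ → ℝ) (x : ℝ) : ℝ :=
  ∑' n : ℕ, r n / 2 ^ n * phi (2 ^ n * x)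

/-- The height of the graph of the signed Takagi function `f_r`:
`height(f) = max_{x ∈ [0,1]} f(x) - min_{x ∈ [0,1]} f(x)` (the function is
continuous, so the sup and inf over `[0,1]` are attained). -/
noncomputable def heightf (r : ℕ → ℝ) : ℝ :=
  sSup (takagi r '' Set.Icc 0 1) - sInf (takagi r '' Set.Icc 0 1)

/-- The classical Takagi function `T`. -/
noncomputable def takagiT : ℝ → ℝ := takagi (fun _ => 1)

/-- The function `T̃(x) = T(x) - 2 φ(x)`. -/
noncomputable def takagiTtilde : ℝ → ℝ := fun x => takagiT x - 2 * phi x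

lemma phi_nonneg (x : ℝ) : 0 ≤ phi x := abs_nonneg _

lemma phi_le_half (x : ℝ) : phi x ≤ 1 / 2 := abs_sub_round x

lemma phi_add_int (x : ℝ) (k : ℤ) : phi (x + k) = phi x := by
  unfold phi
  rw [round_add_intCast]
  push_cast
  congr 1
  ring

lemma phi_neg (x : ℝ) : phi (-x) = phi x := by
  have key : ∀ y : ℝ, phi (-y) ≤ phi y := fun y => by
    have h := round_le (-y) (-round y)
    unfold phi
    refine h.trans (le_of_eq ?_)
    rw [← abs_neg]
    push_cast
    congr 1
    ring
  exact le_antisymm (key x) (by simpa using key (-x))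

lemma phi_of_le_half {x : ℝ} (h0 : 0 ≤ x) (h1 : x ≤ 1 / 2) : phi x = x := by
  apply le_antisymm
  · have h := round_le x 0
    simpa [phi, abs_of_nonneg h0] using h
  · unfold phi
    rcases le_or_gt (round x) 0 with hr | hr
    · have : (round x : ℝ) ≤ 0 := by exact_mod_cast hr
      exact le_trans (by linarith) (le_abs_self _)
    · have : (1 : ℝ) ≤ round x := by exact_mod_cast hr
      exact le_trans (by linarith) (neg_le_abs _)

lemma phi_of_half_le {x : ℝ} (h0 : 1 / 2 ≤ x) (h1 : x ≤ 1) : phi x = 1 - x := by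
  have h : phi (1 - x) = 1 - x := phi_of_le_half (by linarith) (by linarith)
  rw [← h, ← phi_neg x, show 1 - x = -x + ((1 : ℤ) : ℝ) by push_cast; ring, phi_add_int]

/-- Every value of `r` is `1` or `-1`. -/
def IsSign (r : ℕ → ℝ) : Prop := ∀ n, r n = 1 ∨ r n = -1

/-- The sequence `r` with its first term dropped. -/
def tailSeq (r : ℕ → ℝ) : ℕ → ℝ := fun n => r (n + 1)

lemma IsSign.tail {r : ℕ → ℝ} (h : IsSign r) : IsSign (tailSeq r) := fun n => h (n + 1)

lemma IsSign.neg {r : ℕ → ℝ} (h : IsSign r) : IsSign (-r) := fun n => by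
  rcases h n with h | h <;> simp [h]

lemma tailSeq_neg (r : ℕ → ℝ) : tailSeq (-r) = -tailSeq r := rfl

lemma IsSign.abs_term_le {r : ℕ → ℝ} (h : IsSign r) (x : ℝ) (n : ℕ) :
    |r n / 2 ^ n * phi (2 ^ n * x)| ≤ 1 / 2 / 2 ^ n := by
  have h1 : |r n| = 1 := by rcases h n with h | h <;> simp [h]
  rw [abs_mul, abs_div, h1, abs_of_nonneg (phi_nonneg _), abs_of_pos (by positivity)]
  have := phi_le_half (2 ^ n * x)
  calc 1 / 2 ^ n * phi (2 ^ n * x) ≤ 1 / 2 ^ n * (1 / 2) := by gcongr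
    _ = 1 / 2 / 2 ^ n := by ring

lemma IsSign.summable {r : ℕ → ℝ} (h : IsSign r) (x : ℝ) :
    Summable fun n : ℕ => r n / 2 ^ n * phi (2 ^ n * x) :=
  Summable.of_norm_bounded (summable_geometric_two' 1) (h.abs_term_le x)

lemma IsSign.abs_takagi_le {r : ℕ → ℝ} (h : IsSign r) (x : ℝ) : |takagi r x| ≤ 1 :=
  tsum_of_norm_bounded (f := fun n : ℕ => r n / 2 ^ n * phi (2 ^ n * x)) (hasSum_geometric_two' 1) (h.abs_term_le x)

lemma IsSign.takagi_eq {r : ℕ → ℝ} (h : IsSign r) (x : ℝ) :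
    takagi r x = r 0 * phi x + takagi (tailSeq r) (2 * x) / 2 := by
  unfold takagi
  rw [(h.summable x).tsum_eq_zero_add, ← tsum_div_const]
  congr 1
  · simp
  · refine tsum_congr fun n => ?_
    rw [show (2 : ℝ) ^ (n + 1) * x = 2 ^ n * (2 * x) by ring]
    unfold tailSeq
    rw [pow_succ]
    ring

lemma takagi_neg_seq (r : ℕ → ℝ) (x : ℝ) : takagi (-r) x = -takagi r x := by
  unfold takagi
  rw [← tsum_neg]
  refine tsum_congr fun n => ?_
  simp only [Pi.neg_apply]
  ring

lemma takagi_add_one (r : ℕ → ℝ) (x : ℝ) : takagi r (x + 1) = takagi r x := by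
  unfold takagi
  refine tsum_congr fun n => ?_
  rw [← phi_add_int (2 ^ n * x) (2 ^ n)]
  push_cast
  rw [mul_add, mul_one]

lemma takagi_neg (r : ℕ → ℝ) (x : ℝ) : takagi r (-x) = takagi r x := by
  unfold takagi
  refine tsum_congr fun n => ?_
  rw [mul_neg, phi_neg]

lemma takagi_one_sub (r : ℕ → ℝ) (x : ℝ) : takagi r (1 - x) = takagi r x := by
  rw [sub_eq_neg_add, takagi_add_one, takagi_neg]

lemma takagi_one (r : ℕ → ℝ) : takagi r 1 = 0 := by
  rw [← takagi_one_sub, sub_self]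
  simp [takagi, phi]

/-- The supremum over `[0, 1]` of `f_r` tilted by a linear function of slope `a`
vanishing at `1 / 2`. -/
noncomputable def tiltedSup (a : ℝ) (r : ℕ → ℝ) : ℝ :=
  sSup ((fun u => a * (u - 1 / 2) + takagi r u) '' Set.Icc 0 1)

lemma tiltedSup_le {a : ℝ} {r : ℕ → ℝ} {c : ℝ}
    (h : ∀ u, 0 ≤ u → u ≤ 1 → a * (u - 1 / 2) + takagi r u ≤ c) : tiltedSup a r ≤ c := by
  apply csSup_le
  · exact Set.Nonempty.image _ ⟨0, by simp⟩
  · rintro _ ⟨u, ⟨h0, h1⟩, rfl⟩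
    exact h u h0 h1

lemma tilted_le_abs {a u : ℝ} (h0 : 0 ≤ u) (h1 : u ≤ 1) : a * (u - 1 / 2) ≤ |a| / 2 := by
  have h2 : |u - 1 / 2| ≤ 1 / 2 := by rw [abs_le]; constructor <;> linarith
  have h3 := le_abs_self (a * (u - 1 / 2))
  rw [abs_mul] at h3
  nlinarith [abs_nonneg a]

lemma IsSign.le_tiltedSup {r : ℕ → ℝ} (h : IsSign r) (a : ℝ) {u : ℝ} (h0 : 0 ≤ u) (h1 : u ≤ 1) :
    a * (u - 1 / 2) + takagi r u ≤ tiltedSup a r := by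
  apply le_csSup
  · refine ⟨|a| / 2 + 1, ?_⟩
    rintro _ ⟨v, ⟨hv0, hv1⟩, rfl⟩
    exact add_le_add (tilted_le_abs hv0 hv1) ((le_abs_self _).trans (h.abs_takagi_le v))
  · exact ⟨u, ⟨h0, h1⟩, rfl⟩

lemma IsSign.tiltedSup_le_abs {r : ℕ → ℝ} (h : IsSign r) (a : ℝ) :
    tiltedSup a r ≤ |a| / 2 + 1 :=
  tiltedSup_le fun v h0 h1 =>
    add_le_add (tilted_le_abs h0 h1) ((le_abs_self _).trans (h.abs_takagi_le v))

lemma IsSign.half_le_tiltedSup {r : ℕ → ℝ} (h : IsSign r) (a : ℝ) : a / 2 ≤ tiltedSup a r := by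
  have := h.le_tiltedSup a zero_le_one le_rfl
  rw [takagi_one] at this
  linarith

lemma IsSign.tiltedSup_neg {r : ℕ → ℝ} (h : IsSign r) (a : ℝ) :
    tiltedSup (-a) r = tiltedSup a r := by
  have key : ∀ b : ℝ, tiltedSup (-b) r ≤ tiltedSup b r := fun b =>
    tiltedSup_le fun u h0 h1 => by
      have := h.le_tiltedSup b (u := 1 - u) (by linarith) (by linarith)
      rw [takagi_one_sub] at this
      linarith
  exact le_antisymm (key a) (by simpa using key (-a))

lemma IsSign.tiltedSup_eq {r : ℕ → ℝ} (h : IsSign r) {a : ℝ} (ha : 0 ≤ a) :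
    tiltedSup a r = (tiltedSup (a - r 0) (tailSeq r) + (r 0 + a) / 2) / 2 := by
  have right : ∀ v, 0 ≤ v → v ≤ 1 → takagi r ((v + 1) / 2) =
      r 0 * ((1 - v) / 2) + takagi (tailSeq r) v / 2 := fun v h0 h1 => by
    rw [h.takagi_eq, phi_of_half_le (by linarith) (by linarith),
      show 2 * ((v + 1) / 2) = v + 1 by ring, takagi_add_one]
    ring
  apply le_antisymm
  · have upper : ∀ u, 1 / 2 ≤ u → u ≤ 1 → a * (u - 1 / 2) + takagi r u ≤
        (tiltedSup (a - r 0) (tailSeq r) + (r 0 + a) / 2) / 2 := fun u h0 h1 => by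
      have e := right (2 * u - 1) (by linarith) (by linarith)
      rw [show (2 * u - 1 + 1) / 2 = u by ring] at e
      have := h.tail.le_tiltedSup (a - r 0) (u := 2 * u - 1) (by linarith) (by linarith)
      rw [e]
      linarith
    refine tiltedSup_le fun u h0 h1 => ?_
    rcases le_total (1 / 2) u with hu | hu
    · exact upper u hu h1
    · have := upper (1 - u) (by linarith) (by linarith)
      rw [takagi_one_sub] at this
      nlinarith
  · have : tiltedSup (a - r 0) (tailSeq r) ≤ 2 * tiltedSup a r - (r 0 + a) / 2 :=
      tiltedSup_le fun v h0 h1 => by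
        have := h.le_tiltedSup a (u := (v + 1) / 2) (by linarith) (by linarith)
        rw [right v h0 h1] at this
        linarith
    linarith

/-- The excess of `max (f_r + a (u - 1/2)) + max (-f_r + b (u - 1/2))` over `(a + b) / 2`. -/
noncomputable def excess (a b : ℕ) (r : ℕ → ℝ) : ℝ :=
  tiltedSup a r + tiltedSup b (-r) - (a + b) / 2

lemma heightf_eq_excess (r : ℕ → ℝ) : heightf r = excess 0 0 r := by
  unfold heightf excess tiltedSup
  rw [Real.sInf_def, ← Set.image_neg_eq_neg, Set.image_image]
  simp [takagi_neg_seq]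

lemma excess_swap (a b : ℕ) (r : ℕ → ℝ) : excess a b (-r) = excess b a r := by
  unfold excess
  rw [neg_neg]
  ring

namespace IsSign

variable {r : ℕ → ℝ}

lemma excess_le_two (h : IsSign r) (a b : ℕ) : excess a b r ≤ 2 := by
  have h1 := h.tiltedSup_le_abs a
  have h2 := h.neg.tiltedSup_le_abs b
  rw [Nat.abs_cast] at h1 h2
  unfold excess
  linarith

lemma excess_nonneg (h : IsSign r) (a b : ℕ) : 0 ≤ excess a b r := by
  have h1 := h.half_le_tiltedSup a
  have h2 := h.neg.half_le_tiltedSup b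
  unfold excess
  linarith

lemma excess_zero_left (h : IsSign r) (h0 : r 0 = 1) (b : ℕ) :
    excess 0 b r = 1 / 2 + excess 1 (b + 1) (tailSeq r) / 2 := by
  unfold excess
  rw [h.tiltedSup_eq (Nat.cast_nonneg _), h.neg.tiltedSup_eq (Nat.cast_nonneg _), tailSeq_neg]
  have := h.tail.tiltedSup_neg 1
  simp only [Pi.neg_apply, h0, Nat.cast_zero, zero_sub, this]
  push_cast
  rw [sub_neg_eq_add]
  ring

lemma excess_succ_left (h : IsSign r) (h0 : r 0 = 1) (a b : ℕ) :
    excess (a + 1) b r = excess a (b + 1) (tailSeq r) / 2 := by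
  unfold excess
  rw [h.tiltedSup_eq (Nat.cast_nonneg _), h.neg.tiltedSup_eq (Nat.cast_nonneg _), tailSeq_neg]
  simp only [Pi.neg_apply, h0]
  push_cast
  rw [sub_neg_eq_add, add_sub_cancel_right]
  ring

lemma excess_succ_right (h : IsSign r) (h0 : r 0 = -1) (a b : ℕ) :
    excess a (b + 1) r = excess (a + 1) b (tailSeq r) / 2 := by
  rw [← excess_swap, h.neg.excess_succ_left (by simp [h0]), tailSeq_neg, excess_swap]

lemma excess_zero_right (h : IsSign r) (h0 : r 0 = -1) (a : ℕ) :
    excess a 0 r = 1 / 2 + excess (a + 1) 1 (tailSeq r) / 2 := by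
  rw [← excess_swap, h.neg.excess_zero_left (by simp [h0]), tailSeq_neg, excess_swap]

lemma excess_le_add_pow (n : ℕ) : ∀ r, IsSign r →
    (∀ a b, excess a b r ≤ 2 / 3 + 2 / 2 ^ n) ∧
      ∀ a b, excess (a + 1) (b + 1) r ≤ 1 / 3 + 2 / 2 ^ n := by
  induction n with
  | zero =>
    intro r h
    constructor <;> intro a b <;> norm_num
    · linarith [h.excess_le_two a b]
    · linarith [h.excess_le_two (a + 1) (b + 1)]
  | succ n ih =>
    intro r h
    obtain ⟨ih1, ih2⟩ := ih _ h.tail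
    have e : (2 : ℝ) / 2 ^ (n + 1) = 2 / 2 ^ n / 2 := by rw [pow_succ]; ring
    have pos : (0 : ℝ) < 2 / 2 ^ n := by positivity
    rw [e]
    constructor
    · intro a b
      rcases h 0 with h0 | h0
      · cases a with
        | zero => rw [h.excess_zero_left h0]; linarith [ih2 0 b]
        | succ a => rw [h.excess_succ_left h0]; linarith [ih1 a (b + 1)]
      · cases b with
        | zero => rw [h.excess_zero_right h0]; linarith [ih2 a 0]
        | succ b => rw [h.excess_succ_right h0]; linarith [ih1 (a + 1) b]
    · intro a b
      rcases h 0 with h0 | h0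
      · rw [h.excess_succ_left h0]; linarith [ih1 a (b + 1 + 1)]
      · rw [h.excess_succ_right h0]; linarith [ih1 (a + 1 + 1) b]

lemma tendsto_two_div_pow :
    Filter.Tendsto (fun n : ℕ => (2 : ℝ) / 2 ^ n) Filter.atTop (nhds 0) := by
  have := (tendsto_pow_atTop_nhds_zero_of_lt_one (r := (1 / 2 : ℝ)) (by norm_num)
    (by norm_num)).const_mul 2
  simpa [div_eq_mul_inv] using this

lemma excess_le (h : IsSign r) (a b : ℕ) : excess a b r ≤ 2 / 3 := by
  refine ge_of_tendsto' (x := Filter.atTop) ?_ fun n => (excess_le_add_pow n r h).1 a b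
  simpa using tendsto_two_div_pow.const_add (2 / 3)

lemma excess_succ_succ_le (h : IsSign r) (a b : ℕ) : excess (a + 1) (b + 1) r ≤ 1 / 3 := by
  refine ge_of_tendsto' (x := Filter.atTop) ?_ fun n => (excess_le_add_pow n r h).2 a b
  simpa only [add_zero] using tendsto_two_div_pow.const_add (1 / 3)

lemma of_excess_zero_left_eq (h : IsSign r) {b : ℕ} (e : excess 0 (b + 1) r = 2 / 3) :
    r 0 = 1 ∧ r 1 = 1 ∧ excess 0 (b + 3) (tailSeq (tailSeq r)) = 2 / 3 := by
  rcases h 0 with h0 | h0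
  · rw [h.excess_zero_left h0] at e
    rcases h 1 with h1 | h1
    · rw [h.tail.excess_succ_left (a := 0) h1] at e
      exact ⟨h0, h1, by linarith⟩
    · rw [h.tail.excess_succ_right h1] at e
      linarith [h.tail.tail.excess_succ_succ_le 1 b]
  · rw [h.excess_succ_right h0] at e
    linarith [h.tail.excess_le (0 + 1) b]

lemma eq_one_of_excess_zero_left_eq (n : ℕ) : ∀ r, IsSign r → ∀ b,
    excess 0 (b + 1) r = 2 / 3 → r n = 1 := by
  induction n using Nat.twoStepInduction with
  | zero => exact fun r h b e => (h.of_excess_zero_left_eq e).1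
  | one => exact fun r h b e => (h.of_excess_zero_left_eq e).2.1
  | more n ih _ =>
    exact fun r h b e => ih _ h.tail.tail (b + 2) (h.of_excess_zero_left_eq e).2.2

lemma excess_zero_zero (h : IsSign r) :
    excess 0 0 r = 1 / 2 + excess 1 1 (tailSeq r) / 2 := by
  rcases h 0 with h0 | h0
  · exact h.excess_zero_left h0 0
  · exact h.excess_zero_right h0 0

lemma sub_le_excess_one (n : ℕ) : ∀ b, 2 / 3 - 2 / 2 ^ n ≤ excess 0 b 1 := by
  have h : IsSign 1 := fun _ => Or.inl rfl
  induction n with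
  | zero => intro b; norm_num; linarith [h.excess_nonneg 0 b]
  | succ n ih =>
    intro b
    have e : (2 : ℝ) / 2 ^ (n + 1) = 2 / 2 ^ n / 2 := by rw [pow_succ]; ring
    have pos : (0 : ℝ) < 2 / 2 ^ n := by positivity
    rw [h.excess_zero_left rfl, h.tail.excess_succ_left (a := 0) rfl, e]
    have := ih (b + 1 + 1)
    rw [show tailSeq (tailSeq 1) = 1 from rfl]
    linarith

lemma excess_one_eq (b : ℕ) : excess 0 b 1 = 2 / 3 := by
  apply le_antisymm (excess_le (fun _ => Or.inl rfl) 0 b)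
  refine le_of_tendsto' (x := Filter.atTop) ?_ fun n => sub_le_excess_one n b
  simpa using tendsto_two_div_pow.const_sub (2 / 3)

lemma heightf_of_eq_one (h : IsSign r) (h1 : ∀ n, 1 ≤ n → r n = 1) : heightf r = 2 / 3 := by
  have e : tailSeq (tailSeq r) = 1 := funext fun n => h1 _ (by omega)
  rw [heightf_eq_excess, h.excess_zero_zero,
    h.tail.excess_succ_left (a := 0) (h1 1 le_rfl), e, excess_one_eq]
  norm_num

lemma heightf_neg : heightf (-r) = heightf r := by
  rw [heightf_eq_excess, heightf_eq_excess, excess_swap]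

lemma eq_one_of_heightf_eq (h : IsSign r) (e : heightf r = 2 / 3) (h1 : r 1 = 1) :
    ∀ n, 1 ≤ n → r n = 1 := by
  rw [heightf_eq_excess, h.excess_zero_zero, h.tail.excess_succ_left (a := 0) h1] at e
  intro n hn
  match n, hn with
  | 1, _ => exact h1
  | n + 2, _ =>
    exact eq_one_of_excess_zero_left_eq n _ h.tail.tail 1 (by linarith)

lemma heightf_eq_two_thirds_iff (h : IsSign r) :
    heightf r = 2 / 3 ↔ (∀ n, 1 ≤ n → r n = 1) ∨ ∀ n, 1 ≤ n → r n = -1 := by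
  constructor
  · intro e
    rcases h 1 with h1 | h1
    · exact Or.inl (h.eq_one_of_heightf_eq e h1)
    · refine Or.inr fun n hn => ?_
      have := h.neg.eq_one_of_heightf_eq (heightf_neg.trans e) (by simp [h1]) n hn
      simp only [Pi.neg_apply] at this
      linarith
  · rintro (h1 | h1)
    · exact h.heightf_of_eq_one h1
    · rw [← heightf_neg]
      exact h.neg.heightf_of_eq_one fun n hn => by simp [h1 n hn]

end IsSign

lemma takagiT_eq (x : ℝ) : takagiT x = phi x + takagiT (2 * x) / 2 := by
  have h : IsSign fun _ => 1 := fun _ => Or.inl rfl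
  have e := h.takagi_eq x
  rwa [one_mul] at e

lemma takagi_of_one_one {r : ℕ → ℝ} (h0 : r 0 = 1) (h1 : ∀ n, 1 ≤ n → r n = 1) :
    takagi r = takagiT := by
  have : r = fun _ => 1 := funext fun n => by
    cases n with
    | zero => exact h0
    | succ n => exact h1 _ (by omega)
  rw [this, takagiT]

lemma takagi_of_neg_one_one {r : ℕ → ℝ} (h0 : r 0 = -1) (h1 : ∀ n, 1 ≤ n → r n = 1) :
    takagi r = takagiTtilde := by
  have h : IsSign r := fun n => by
    cases n with
    | zero => exact Or.inr h0
    | succ n => exact Or.inl (h1 _ (by omega))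
  have e : tailSeq r = fun _ => 1 := funext fun n => h1 _ (by omega)
  funext x
  have e' := takagiT_eq x
  rw [h.takagi_eq, e, h0, takagiTtilde, e', takagiT]
  ring

lemma takagiT_half : takagiT (1 / 2) = 1 / 2 := by
  rw [takagiT_eq, phi_of_le_half (by norm_num) le_rfl, show (2 : ℝ) * (1 / 2) = 1 by norm_num,
    takagiT, takagi_one]
  norm_num

lemma takagiT_quarter : takagiT (1 / 4) = 1 / 2 := by
  rw [takagiT_eq, phi_of_le_half (by norm_num) (by norm_num),
    show (2 : ℝ) * (1 / 4) = 1 / 2 by norm_num, takagiT_half]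
  norm_num

lemma takagiTtilde_half : takagiTtilde (1 / 2) = -1 / 2 := by
  rw [takagiTtilde, takagiT_half, phi_of_le_half (by norm_num) le_rfl]
  norm_num

lemma takagiTtilde_quarter : takagiTtilde (1 / 4) = 0 := by
  rw [takagiTtilde, takagiT_quarter, phi_of_le_half (by norm_num) (by norm_num)]
  norm_num

lemma takagi_eq_neg_of_neg {r : ℕ → ℝ} {g : ℝ → ℝ} (h : takagi (-r) = g) :
    takagi r = fun x => -g x := by
  funext x
  rw [← h, takagi_neg_seq, neg_neg]

lemma ncard_takagi_family :
    ({takagiT, fun x => -takagiT x, takagiTtilde, fun x => -takagiTtilde x} :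
        Set (ℝ → ℝ)).ncard = 4 := by
  have ne : ∀ {f g : ℝ → ℝ} (x : ℝ), f x ≠ g x → f ≠ g := fun x hx e => hx (congrFun e x)
  have h1 := takagiT_half
  have h2 := takagiT_quarter
  have h3 := takagiTtilde_half
  have h4 := takagiTtilde_quarter
  rw [Set.ncard_insert_of_notMem, Set.ncard_insert_of_notMem, Set.ncard_pair]
  · exact ne (1 / 2) (by rw [h3]; norm_num)
  · simp only [Set.mem_insert_iff, Set.mem_singleton_iff, not_or]
    exact ⟨ne (1 / 4) (by rw [h2, h4]; norm_num), ne (1 / 4) (by rw [h2, h4]; norm_num)⟩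
  · simp only [Set.mem_insert_iff, Set.mem_singleton_iff, not_or]
    exact ⟨ne (1 / 2) (by rw [h1]; norm_num), ne (1 / 4) (by rw [h2, h4]; norm_num),
      ne (1 / 4) (by rw [h2, h4]; norm_num)⟩

lemma mem_takagi_family_iff (g : ℝ → ℝ) :
    (∃ r : ℕ → ℝ, IsSign r ∧ g = takagi r ∧ heightf r = 2 / 3) ↔
      g = takagiT ∨ g = (fun x => -takagiT x) ∨ g = takagiTtilde ∨
        g = fun x => -takagiTtilde x := by
  constructor
  · rintro ⟨r, h, rfl, e⟩
    rcases h.heightf_eq_two_thirds_iff.1 e with h1 | h1 <;> rcases h 0 with h0 | h0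
    · exact Or.inl (takagi_of_one_one h0 h1)
    · exact Or.inr (Or.inr (Or.inl (takagi_of_neg_one_one h0 h1)))
    · exact Or.inr (Or.inr (Or.inr (takagi_eq_neg_of_neg
        (takagi_of_neg_one_one (by simp [h0]) fun n hn => by simp [h1 n hn]))))
    · exact Or.inr (Or.inl (takagi_eq_neg_of_neg
        (takagi_of_one_one (by simp [h0]) fun n hn => by simp [h1 n hn])))
  · have hT : IsSign fun _ => 1 := fun _ => Or.inl rfl
    let s : ℕ → ℝ := fun n => if n = 0 then -1 else 1
    have hs : IsSign s := fun n => by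
      by_cases hn : n = 0 <;> simp [s, hn]
    have hs1 : ∀ n, 1 ≤ n → s n = 1 := fun n hn => by simp [s, show n ≠ 0 by omega]
    have es : takagi s = takagiTtilde := takagi_of_neg_one_one (by simp [s]) hs1
    have hT1 := hT.heightf_of_eq_one fun _ _ => rfl
    have hs2 := hs.heightf_of_eq_one hs1
    rintro (rfl | rfl | rfl | rfl)
    · exact ⟨_, hT, rfl, hT1⟩
    · exact ⟨_, hT.neg, (takagi_eq_neg_of_neg (by rw [neg_neg]; rfl)).symm,
        IsSign.heightf_neg.trans hT1⟩
    · exact ⟨s, hs, es.symm, hs2⟩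
    · exact ⟨-s, hs.neg, (takagi_eq_neg_of_neg (by rw [neg_neg, es])).symm,
        IsSign.heightf_neg.trans hs2⟩

/-- For a sign sequence `r`, `height(f_r) = 2/3` iff `r_n = 1` for all `n ≥ 1` or
`r_n = -1` for all `n ≥ 1`; consequently there are exactly four signed Takagi
functions of height `2/3`, namely `±T` and `±T̃`. -/
theorem height_two_thirds_iff :
    (∀ r : ℕ → ℝ, (∀ n, r n = 1 ∨ r n = -1) →
      (heightf r = 2 / 3 ↔ ((∀ n, 1 ≤ n → r n = 1) ∨ (∀ n, 1 ≤ n → r n = -1)))) ∧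
    {g : ℝ → ℝ | ∃ r : ℕ → ℝ, (∀ n, r n = 1 ∨ r n = -1) ∧ g = takagi r ∧
        heightf r = 2 / 3}
      = {takagiT, fun x => -takagiT x, takagiTtilde, fun x => -takagiTtilde x} ∧
    ({takagiT, fun x => -takagiT x, takagiTtilde, fun x => -takagiTtilde x} :
        Set (ℝ → ℝ)).ncard = 4 := by
  exact ⟨fun r h => IsSign.heightf_eq_two_thirds_iff h,
    Set.ext fun g => mem_takagi_family_iff g, ncard_takagi_family⟩
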